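/- arXiv:2109.03725 — 3 statements merged into one kernel-verified Lean document; each statement's English description precedes it below -/
import Mathlib

section
/- Let (Z,ρ₀) be an antipodal space. Then (M(Z), d_M) is a geodesic metric space: for any two points ρ₁, ρ₂ ∈ M(Z) there exists an isometric embedding γ : [0, d_M(ρ₁,ρ₂)] → M(Z) with γ(0) = ρ₁ and γ(d_M(ρ₁,ρ₂)) = ρ₂. -/
open Filter Topology
open scoped Classical

variable {Z : Type*}

/-- `Z` has at least four points. -/
def HasFourPoints (Z : Type*) : Prop :=
  ∃ a b c d : Z, a ≠ b ∧ a ≠ c ∧ a ≠ d ∧ b ≠ c ∧ b ≠ d ∧ c ≠ d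

/-- A separating function on `Z`: continuous, symmetric, and positive. -/
structure IsSeparating [TopologicalSpace Z] (ρ : Z → Z → ℝ) : Prop where
  continuous : Continuous fun p : Z × Z => ρ p.1 p.2
  symm : ∀ ξ η, ρ ξ η = ρ η ξ
  nonneg : ∀ ξ η, 0 ≤ ρ ξ η
  eq_zero_iff : ∀ ξ η, ρ ξ η = 0 ↔ ξ = η

/-- The cross-ratio of a quadruple of points with respect to `ρ`. -/
noncomputable def crossRatio (ρ : Z → Z → ℝ) (ξ ξ' η η' : Z) : ℝ :=
  ρ ξ η * ρ ξ' η' / (ρ ξ η' * ρ ξ' η)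

/-- Two functions are Moebius equivalent if their cross-ratios agree on all quadruples
of pairwise distinct points. -/
def MoebiusEquiv (ρ₁ ρ₂ : Z → Z → ℝ) : Prop :=
  ∀ ξ ξ' η η' : Z, ξ ≠ ξ' → ξ ≠ η → ξ ≠ η' → ξ' ≠ η → ξ' ≠ η' → η ≠ η' →
    crossRatio ρ₁ ξ ξ' η η' = crossRatio ρ₂ ξ ξ' η η'

/-- An antipodal function on `Z`: a separating function with values in `[0,1]` such that
every point has an antipode. -/
structure IsAntipodal [TopologicalSpace Z] (ρ : Z → Z → ℝ) : Prop where
  toIsSeparating : IsSeparating ρ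
  le_one : ∀ ξ η, ρ ξ η ≤ 1
  antipode : ∀ ξ, ∃ η, ρ ξ η = 1

/-- The Moebius space `M(Z, ρ₀)`: antipodal functions Moebius equivalent to `ρ₀`. -/
def MoebiusSpace [TopologicalSpace Z] (ρ₀ : Z → Z → ℝ) : Set (Z → Z → ℝ) :=
  {ρ | IsAntipodal ρ ∧ MoebiusEquiv ρ₀ ρ}

/-- The derivative `dρ₂/dρ₁`: the (unique, when it exists) positive continuous function
satisfying the geometric mean value theorem
`ρ₂(ξ,η)² = f(ξ) f(η) ρ₁(ξ,η)²`. -/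
noncomputable def mDeriv [TopologicalSpace Z] (ρ₁ ρ₂ : Z → Z → ℝ) : Z → ℝ :=
  if h : ∃ f : Z → ℝ, Continuous f ∧ (∀ ξ, 0 < f ξ) ∧
      ∀ ξ η, ρ₂ ξ η ^ 2 = f ξ * f η * ρ₁ ξ η ^ 2
  then h.choose else fun _ => 1

/-- The metric `d_M(ρ₁, ρ₂) = ‖log (dρ₂/dρ₁)‖_∞` on the Moebius space. -/
noncomputable def dM [TopologicalSpace Z] (ρ₁ ρ₂ : Z → Z → ℝ) : ℝ :=
  ⨆ ξ : Z, |Real.log (mDeriv ρ₁ ρ₂ ξ)|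

/-- The discrepancy function `D_{ρ₁}(τ)(ξ) = max_{η ≠ ξ} (τ(ξ) + τ(η) + log ρ₁(ξ,η)²)`. -/
noncomputable def discrepancy [TopologicalSpace Z] (ρ₁ : Z → Z → ℝ) (τ : C(Z, ℝ))
    (ξ : Z) : ℝ :=
  ⨆ η : {η : Z // η ≠ ξ}, (τ ξ + τ η.1 + Real.log (ρ₁ ξ η.1 ^ 2))

/-- `E_{ρ₁}(τ)(ξ,η) = e^{τ(ξ)/2} e^{τ(η)/2} ρ₁(ξ,η)`. -/
noncomputable def eMap [TopologicalSpace Z] (ρ₁ : Z → Z → ℝ) (τ : C(Z, ℝ)) :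
    Z → Z → ℝ :=
  fun ξ η => Real.exp (τ ξ / 2) * Real.exp (τ η / 2) * ρ₁ ξ η

/-- A solution of the `ρ₁`-antipodal flow `dτ_t/dt = -D_{ρ₁}(τ_t)` on `[0, ∞)`. -/
def IsAntipodalFlowSol [TopologicalSpace Z] [CompactSpace Z]
    (ρ₁ : Z → Z → ℝ) (τ : ℝ → C(Z, ℝ)) : Prop :=
  ∀ t ∈ Set.Ici (0 : ℝ), ∃ τ' : C(Z, ℝ),
    (∀ ξ, τ' ξ = -discrepancy ρ₁ (τ t) ξ) ∧
    HasDerivWithinAt τ τ' (Set.Ici (0 : ℝ)) t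

/-- The antipodalization map `P_∞(τ₀, ρ₁) = E_{ρ₁}(τ_∞)`, where `τ_∞` is the limit as
`t → ∞` of the solution of the `ρ₁`-antipodal flow starting at `τ₀`. -/
noncomputable def antipodalization [TopologicalSpace Z] [CompactSpace Z]
    (ρ₁ : Z → Z → ℝ) (τ₀ : C(Z, ℝ)) : Z → Z → ℝ :=
  if h : ∃ p : (ℝ → C(Z, ℝ)) × C(Z, ℝ), p.1 0 = τ₀ ∧ IsAntipodalFlowSol ρ₁ p.1 ∧
      Filter.Tendsto p.1 Filter.atTop (𝓝 p.2)
  then eMap ρ₁ h.choose.2 else ρ₁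


/-- `g` is the conjugate of `f` with respect to the kernel `log ρ²`, that is
`g x = max_y (log (ρ x y ^ 2) - f y)`. -/
def IsConjugate [TopologicalSpace Z] (ρ : Z → Z → ℝ) (f g : C(Z, ℝ)) : Prop :=
  (∀ x y, ρ x y ^ 2 ≤ Real.exp (g x + f y)) ∧ ∀ x, ∃ y, ρ x y ^ 2 = Real.exp (g x + f y)

/-- The functions `f` for which `exp (-(f x + f y) / 2) * ρ x y` is bounded by one. -/
def Dominates [TopologicalSpace Z] (ρ : Z → Z → ℝ) (f : C(Z, ℝ)) : Prop :=
  ∀ x y, ρ x y ^ 2 ≤ Real.exp (f x + f y)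

theorem IsAntipodal.exists_isConjugate [TopologicalSpace Z] [CompactSpace Z]
    {ρ : Z → Z → ℝ} (h : IsAntipodal ρ) (f : C(Z, ℝ)) : ∃ g, IsConjugate ρ f g := by
  let F : Z → Z → ℝ := fun x y => ρ x y ^ 2 * Real.exp (-f y)
  have hF : Continuous (Function.uncurry F) := by
    have h1 := h.toIsSeparating.continuous
    have h2 := f.continuous
    exact (h1.pow 2).mul (Real.continuous_exp.comp (h2.comp continuous_snd).neg)
  let S : Z → ℝ := fun x => sSup (F x '' Set.univ)
  have hS : Continuous S := isCompact_univ.continuous_sSup hF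
  have hFx : ∀ x, Continuous (F x) := fun x => hF.comp (Continuous.prodMk_right x)
  have hmax : ∀ x, ∃ y, S x = F x y ∧ ∀ z, F x z ≤ F x y := by
    intro x
    obtain ⟨y, -, hy, hz⟩ := isCompact_univ.exists_sSup_image_eq_and_ge ⟨x, Set.mem_univ x⟩
      (hFx x).continuousOn
    exact ⟨y, hy, fun z => hz z (Set.mem_univ z)⟩
  have hpos : ∀ x, 0 < S x := by
    intro x
    obtain ⟨y, hy, hz⟩ := hmax x
    obtain ⟨w, hw⟩ := h.antipode x
    rw [hy]
    refine lt_of_lt_of_le ?_ (hz w)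
    simp only [F, hw]
    positivity
  have hexp : ∀ x y, Real.exp (Real.log (S x) + f y) = S x * Real.exp (f y) := by
    intro x y
    rw [Real.exp_add, Real.exp_log (hpos x)]
  have hFe : ∀ x y, F x y * Real.exp (f y) = ρ x y ^ 2 := by
    intro x y
    simp only [F]
    rw [mul_assoc, ← Real.exp_add, neg_add_cancel, Real.exp_zero, mul_one]
  refine ⟨⟨fun x => Real.log (S x), hS.log fun x => (hpos x).ne'⟩, fun x y => ?_, fun x => ?_⟩
  · change _ ≤ Real.exp (Real.log (S x) + f y)
    obtain ⟨w, hw, hz⟩ := hmax x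
    rw [hexp, ← hFe x y, hw]
    exact mul_le_mul_of_nonneg_right (hz y) (Real.exp_pos _).le
  · obtain ⟨w, hw, -⟩ := hmax x
    refine ⟨w, ?_⟩
    change _ = Real.exp (Real.log (S x) + f w)
    rw [hexp, ← hFe x w, hw]

section Retraction

variable [TopologicalSpace Z] {ρ : Z → Z → ℝ}

theorem IsConjugate.le_of_dominates {f g : C(Z, ℝ)} (h : IsConjugate ρ f g)
    (hf : Dominates ρ f) (x : Z) : g x ≤ f x := by
  obtain ⟨y, hy⟩ := h.2 x
  have := hf x y
  rw [hy, Real.exp_le_exp] at this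
  linarith

theorem IsConjugate.antitone {f g f' g' : C(Z, ℝ)} (h : IsConjugate ρ f g)
    (h' : IsConjugate ρ f' g') (hff' : ∀ x, f x ≤ f' x) (x : Z) : g' x ≤ g x := by
  obtain ⟨y, hy⟩ := h'.2 x
  have := h.1 x y
  rw [hy, Real.exp_le_exp] at this
  linarith [hff' y]

theorem IsConjugate.dist_le [CompactSpace Z] {f g f' g' : C(Z, ℝ)} (h : IsConjugate ρ f g)
    (h' : IsConjugate ρ f' g') : dist g g' ≤ dist f f' := by
  rw [ContinuousMap.dist_le dist_nonneg]
  intro x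
  have key : ∀ {f g f' g' : C(Z, ℝ)}, IsConjugate ρ f g → IsConjugate ρ f' g' →
      g x - g' x ≤ dist f f' := by
    intro f g f' g' h h'
    obtain ⟨y, hy⟩ := h.2 x
    have h1 := h'.1 x y
    rw [hy, Real.exp_le_exp] at h1
    have h2 := ContinuousMap.dist_apply_le_dist (f := f) (g := f') y
    rw [Real.dist_eq] at h2
    linarith [neg_abs_le (f y - f' y)]
  rw [Real.dist_eq, abs_sub_le_iff]
  exact ⟨key h h', (key h' h).trans_eq (dist_comm _ _)⟩

theorem Dominates.midpoint {f g : C(Z, ℝ)} (hρ : ∀ x y, ρ x y = ρ y x)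
    (h : IsConjugate ρ f g) : Dominates ρ ((1 / 2 : ℝ) • (f + g)) := by
  intro x y
  have h1 := h.1 x y
  have h2 := h.1 y x
  rw [hρ y x] at h2
  simp only [ContinuousMap.smul_apply, ContinuousMap.add_apply, smul_eq_mul]
  rcases le_total (g x + f y) (g y + f x) with h3 | h3
  · exact h1.trans (Real.exp_le_exp.2 (by linarith))
  · exact h2.trans (Real.exp_le_exp.2 (by linarith))

/-- The nonexpansive retraction of the dominating functions onto the self-conjugate ones. -/
theorem exists_retraction [CompactSpace Z] (hρ : ∀ x y, ρ x y = ρ y x)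
    (hex : ∀ f : C(Z, ℝ), ∃ g, IsConjugate ρ f g) :
    ∃ p : C(Z, ℝ) → C(Z, ℝ), (∀ f, Dominates ρ f → IsConjugate ρ (p f) (p f)) ∧
      (∀ f, IsConjugate ρ f f → p f = f) ∧
      ∀ f g, Dominates ρ f → Dominates ρ g → dist (p f) (p g) ≤ dist f g := by
  choose star hstar using hex
  let q : C(Z, ℝ) → C(Z, ℝ) := fun f => (1 / 2 : ℝ) • (f + star f)
  have hq : ∀ f x, q f x = (f x + star f x) / 2 := by
    intro f x
    simp only [q, ContinuousMap.smul_apply, ContinuousMap.add_apply, smul_eq_mul]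
    ring
  have hqdist : ∀ f g, dist (q f) (q g) ≤ dist f g := by
    intro f g
    have h1 := (hstar f).dist_le (hstar g)
    have h2 : dist (q f) (q g) ≤ (1 / 2) * (dist f g + dist (star f) (star g)) := by
      simp only [q]
      rw [dist_eq_norm, ← smul_sub, norm_smul, ← dist_eq_norm, Real.norm_of_nonneg (by norm_num)]
      exact mul_le_mul_of_nonneg_left (dist_add_add_le _ _ _ _) (by norm_num)
    linarith
  have hiter : ∀ n f g, dist (q^[n] f) (q^[n] g) ≤ dist f g := by
    intro n
    induction n with
    | zero => simp
    | succ n ih =>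
      intro f g
      simp only [Function.iterate_succ_apply']
      exact (hqdist _ _).trans (ih f g)
  have hgap : ∀ f, Dominates ρ f → dist (q f) (star (q f)) ≤ dist f (star f) / 2 := by
    intro f hf
    rw [ContinuousMap.dist_le (by positivity)]
    intro x
    have h1 := (hstar f).le_of_dominates hf
    have h2 := (hstar (q f)).antitone (hstar f) (fun x => by rw [hq]; linarith [h1 x]) x
    have h3 := (hstar (q f)).le_of_dominates (Dominates.midpoint hρ (hstar f)) x
    have h4 := ContinuousMap.dist_apply_le_dist (f := f) (g := star f) x
    rw [Real.dist_eq] at h4 ⊢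
    rw [abs_of_nonneg (by linarith), hq]
    linarith [le_abs_self (f x - star f x)]
  have hdecay : ∀ f, Dominates ρ f → ∀ n, Dominates ρ (q^[n] f) ∧
      dist (q^[n] f) (star (q^[n] f)) ≤ dist f (star f) * (1 / 2) ^ n := by
    intro f hf n
    induction n with
    | zero => simpa using hf
    | succ n ih =>
      rw [Function.iterate_succ_apply']
      refine ⟨Dominates.midpoint hρ (hstar _), (hgap _ ih.1).trans ?_⟩
      rw [pow_succ]
      linarith [ih.2]
  have hstep : ∀ f, dist f (q f) ≤ dist f (star f) := by
    intro f
    rw [ContinuousMap.dist_le dist_nonneg]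
    intro x
    have h4 := ContinuousMap.dist_apply_le_dist (f := f) (g := star f) x
    rw [Real.dist_eq] at h4 ⊢
    have h5 : f x - q f x = (f x - star f x) / 2 := by rw [hq]; ring
    rw [h5, abs_div, abs_two]
    linarith [abs_nonneg (f x - star f x)]
  have hlim : ∀ f, ∃ l, Dominates ρ f → Tendsto (fun n => q^[n] f) atTop (𝓝 l) := by
    intro f
    by_cases hf : Dominates ρ f
    · have hc : CauchySeq fun n => q^[n] f := by
        refine cauchySeq_of_le_geometric (1 / 2) (dist f (star f)) (by norm_num) fun n => ?_
        rw [Function.iterate_succ_apply']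
        exact (hstep _).trans (hdecay f hf n).2
      obtain ⟨l, hl⟩ := cauchySeq_tendsto_of_complete hc
      exact ⟨l, fun _ => hl⟩
    · exact ⟨f, fun h => absurd h hf⟩
  choose p hp using hlim
  have hstarc : Continuous star :=
    (LipschitzWith.of_dist_le_mul (K := 1) fun f g => by
      simpa using (hstar f).dist_le (hstar g)).continuous
  refine ⟨p, fun f hf => ?_, fun f hf => ?_, fun f g hf hg => ?_⟩
  · have h1 := (hp f hf).dist ((hstarc.tendsto _).comp (hp f hf))
    have h2 : Tendsto (fun n : ℕ => dist f (star f) * (1 / 2 : ℝ) ^ n) atTop (𝓝 0) := by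
      simpa using (tendsto_pow_atTop_nhds_zero_of_lt_one (r := (1 / 2 : ℝ)) (by norm_num)
        (by norm_num)).const_mul (dist f (star f))
    have h3 := le_of_tendsto_of_tendsto' h1 h2 fun n => (hdecay f hf n).2
    have h4 := hstar (p f)
    rwa [← dist_le_zero.1 h3] at h4
  · have h1 : star f = f := dist_le_zero.1 (by simpa using (hstar f).dist_le hf)
    have h2 : q f = f := by
      ext x
      rw [hq, h1]
      ring
    have h3 := hp f hf.1
    simp only [Function.iterate_fixed h2] at h3
    exact tendsto_nhds_unique h3 tendsto_const_nhds
  · exact le_of_tendsto' ((hp f hf).dist (hp g hg)) fun n => hiter n f g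

end Retraction

theorem HasFourPoints.exists_ne_ne (h : HasFourPoints Z) (x y : Z) :
    ∃ z, z ≠ x ∧ z ≠ y := by
  obtain ⟨a, b, c, -, hab, hac, -, hbc, -, -⟩ := h
  by_contra! H
  by_cases ha : a = x
  · exact hbc ((H b fun hb => hab (ha.trans hb.symm)).trans
      (H c fun hc => hac (ha.trans hc.symm)).symm)
  by_cases hb : b = x
  · exact hac ((H a ha).trans (H c fun hc => hbc (hb.trans hc.symm)).symm)
  · exact hab ((H a ha).trans (H b hb).symm)

theorem HasFourPoints.eq_of_mul_eq_mul (h : HasFourPoints Z) {f g : Z → ℝ}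
    (hf : ∀ x, 0 < f x) (hg : ∀ x, 0 < g x)
    (hfg : ∀ x y, x ≠ y → f x * f y = g x * g y) : f = g := by
  funext x
  obtain ⟨y, hy, -⟩ := h.exists_ne_ne x x
  obtain ⟨z, hzx, hzy⟩ := h.exists_ne_ne x y
  have h1 := hfg x y hy.symm
  have h2 := hfg x z hzx.symm
  have h3 := hfg y z hzy.symm
  have h4 : f x ^ 2 * (g y * g z) = g x ^ 2 * (g y * g z) := by
    calc f x ^ 2 * (g y * g z) = (f x * f y) * (f x * f z) := by rw [← h3]; ring
      _ = g x ^ 2 * (g y * g z) := by rw [h1, h2]; ring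
  have h5 := mul_right_cancel₀ (mul_pos (hg y) (hg z)).ne' h4
  exact (pow_left_inj₀ (hf x).le (hg x).le two_ne_zero).1 h5

theorem mDeriv_eq [TopologicalSpace Z] (h4 : HasFourPoints Z) {ρ₁ ρ₂ : Z → Z → ℝ}
    (h₁ : IsSeparating ρ₁) {f : Z → ℝ} (hc : Continuous f) (hf : ∀ x, 0 < f x)
    (h : ∀ x y, ρ₂ x y ^ 2 = f x * f y * ρ₁ x y ^ 2) : mDeriv ρ₁ ρ₂ = f := by
  have hex : ∃ f : Z → ℝ, Continuous f ∧ (∀ ξ, 0 < f ξ) ∧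
      ∀ ξ η, ρ₂ ξ η ^ 2 = f ξ * f η * ρ₁ ξ η ^ 2 := ⟨f, hc, hf, h⟩
  rw [mDeriv, dif_pos hex]
  obtain ⟨-, h2, h3⟩ := hex.choose_spec
  refine h4.eq_of_mul_eq_mul h2 hf fun x y hxy => ?_
  have h5 : ρ₁ x y ≠ 0 := fun h0 => hxy ((h₁.eq_zero_iff x y).1 h0)
  exact mul_right_cancel₀ (pow_ne_zero 2 h5) ((h3 x y).symm.trans (h x y))

theorem MoebiusEquiv.exists_deriv [TopologicalSpace Z] [T1Space Z] (h4 : HasFourPoints Z)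
    {ρ₁ ρ₂ : Z → Z → ℝ} (h₁ : IsSeparating ρ₁) (h₂ : IsSeparating ρ₂)
    (h : MoebiusEquiv ρ₁ ρ₂) : ∃ f : Z → ℝ, Continuous f ∧ (∀ x, 0 < f x) ∧
      ∀ x y, ρ₂ x y ^ 2 = f x * f y * ρ₁ x y ^ 2 := by
  have hpos : ∀ {ρ : Z → Z → ℝ}, IsSeparating ρ → ∀ x y, x ≠ y → 0 < ρ x y :=
    fun hs x y hxy => lt_of_le_of_ne (hs.nonneg x y)
      fun h0 => hxy ((hs.eq_zero_iff x y).1 h0.symm)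
  let r : Z → Z → ℝ := fun x y => ρ₂ x y / ρ₁ x y
  have hr : ∀ x y, x ≠ y → 0 < r x y := fun x y hxy => div_pos (hpos h₂ x y hxy) (hpos h₁ x y hxy)
  have hrs : ∀ x y, r x y = r y x := fun x y => by simp only [r, h₁.symm x y, h₂.symm x y]
  have hcross : ∀ x y z w, x ≠ y → x ≠ z → x ≠ w → y ≠ z → y ≠ w → z ≠ w →
      r x z * r y w = r x w * r y z := by
    intro x y z w hxy hxz hxw hyz hyw hzw
    have h1 := h x y z w hxy hxz hxw hyz hyw hzw
    simp only [crossRatio] at h1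
    have a1 := (hpos h₁ x z hxz).ne'
    have a2 := (hpos h₁ y w hyw).ne'
    have a3 := (hpos h₁ x w hxw).ne'
    have a4 := (hpos h₁ y z hyz).ne'
    have b3 := (hpos h₂ x w hxw).ne'
    have b4 := (hpos h₂ y z hyz).ne'
    simp only [r]
    field_simp at h1 ⊢
    linarith
  let F : Z → Z → Z → ℝ := fun x y z => r x y * r x z / r y z
  have hF : ∀ x y z, F x y z = F x z y := fun x y z => by
    simp only [F, hrs y z, mul_comm]
  have hF1 : ∀ x y z w, x ≠ y → x ≠ z → x ≠ w → y ≠ z → y ≠ w → F x y z = F x y w := by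
    intro x y z w hxy hxz hxw hyz hyw
    by_cases hzw : z = w
    · rw [hzw]
    · have h1 := hcross x y z w hxy hxz hxw hyz hyw hzw
      have a1 := (hr y z hyz).ne'
      have a2 := (hr y w hyw).ne'
      simp only [F]
      rw [div_eq_div_iff a1 a2, mul_assoc, h1]
      ring
  have hF2 : ∀ x y z y' z', x ≠ y → x ≠ z → y ≠ z → x ≠ y' → x ≠ z' → y' ≠ z' →
      F x y z = F x y' z' := by
    intro x y z y' z' hxy hxz hyz hxy' hxz' hyz'
    by_cases hz : y = z'
    · subst hz
      rw [hF1 x y z y' hxy hxz hxy' hyz hyz'.symm, hF]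
    · rw [hF1 x y z z' hxy hxz hxz' hyz hz, hF, hF1 x z' y y' hxz' hxy hxy' (Ne.symm hz) hyz'.symm,
        hF]
  choose y hy _ using fun x => h4.exists_ne_ne x x
  choose z hzx hzy using fun x => h4.exists_ne_ne x (y x)
  have hval : ∀ x u v, x ≠ u → x ≠ v → u ≠ v → F x (y x) (z x) = F x u v :=
    fun x u v hu hv huv =>
      hF2 x _ _ u v (hy x).symm (hzx x).symm (hzy x).symm hu hv huv
  refine ⟨fun x => F x (y x) (z x), ?_, fun x => ?_, fun x u => ?_⟩
  · rw [continuous_iff_continuousAt]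
    intro x₀
    have hx : ∀ᶠ x in 𝓝 x₀, F x (y x₀) (z x₀) = F x (y x) (z x) := by
      filter_upwards [isOpen_ne.mem_nhds (hy x₀).symm, isOpen_ne.mem_nhds (hzx x₀).symm] with x h1 h2
      exact (hval x _ _ h1 h2 (hzy x₀).symm).symm
    refine ContinuousAt.congr ?_ hx
    have hcr : ∀ w, x₀ ≠ w → ContinuousAt (fun x => r x w) x₀ := by
      intro w hw
      have c1 : Continuous fun x => ρ₁ x w := h₁.continuous.comp (Continuous.prodMk_left w)
      have c2 : Continuous fun x => ρ₂ x w := h₂.continuous.comp (Continuous.prodMk_left w)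
      exact c2.continuousAt.div c1.continuousAt (hpos h₁ x₀ w hw).ne'
    exact ((hcr _ (hy x₀).symm).mul (hcr _ (hzx x₀).symm)).div_const _
  · exact div_pos (mul_pos (hr _ _ (hy x).symm) (hr _ _ (hzx x).symm)) (hr _ _ (hzy x).symm)
  · by_cases hxu : x = u
    · subst hxu
      simp [(h₁.eq_zero_iff x x).2 rfl, (h₂.eq_zero_iff x x).2 rfl]
    · obtain ⟨w, hwx, hwu⟩ := h4.exists_ne_ne x u
      simp only
      rw [hval x u w hxu hwx.symm hwu.symm, hval u x w (Ne.symm hxu) hwu.symm hwx.symm]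
      have a1 := (hr x w hwx.symm).ne'
      have a2 := (hr u w hwu.symm).ne'
      have e : F x u w * F u x w = r x u ^ 2 := by
        simp only [F, hrs u x]
        field_simp
      rw [e]
      have a3 := (hpos h₁ x u hxu).ne'
      simp only [r]
      field_simp

section EMap

variable [TopologicalSpace Z]

theorem eMap_sq (ρ : Z → Z → ℝ) (f : C(Z, ℝ)) (x y : Z) :
    eMap ρ f x y ^ 2 = Real.exp (f x + f y) * ρ x y ^ 2 := by
  have : f x + f y = f x / 2 + f x / 2 + (f y / 2 + f y / 2) := by ring
  rw [this, eMap]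
  simp only [Real.exp_add]
  ring

theorem eMap_neg_sq_le_one_iff (ρ : Z → Z → ℝ) (f : C(Z, ℝ)) (x y : Z) :
    eMap ρ (-f) x y ^ 2 ≤ 1 ↔ ρ x y ^ 2 ≤ Real.exp (f x + f y) := by
  rw [eMap_sq, ContinuousMap.neg_apply, ContinuousMap.neg_apply, ← neg_add, Real.exp_neg,
    inv_mul_le_iff₀ (Real.exp_pos _), mul_one]

theorem eMap_neg_sq_eq_one_iff (ρ : Z → Z → ℝ) (f : C(Z, ℝ)) (x y : Z) :
    eMap ρ (-f) x y ^ 2 = 1 ↔ ρ x y ^ 2 = Real.exp (f x + f y) := by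
  rw [eMap_sq, ContinuousMap.neg_apply, ContinuousMap.neg_apply, ← neg_add, Real.exp_neg,
    inv_mul_eq_iff_eq_mul₀ (Real.exp_pos _).ne', mul_one]

theorem IsSeparating.eMap {ρ : Z → Z → ℝ} (h : IsSeparating ρ) (f : C(Z, ℝ)) :
    IsSeparating (eMap ρ f) where
  continuous := by
    have h1 := h.continuous
    have h2 := f.continuous
    unfold _root_.eMap
    fun_prop
  symm x y := by
    simp only [_root_.eMap, h.symm x y]
    ring
  nonneg x y := mul_nonneg (by positivity) (h.nonneg x y)
  eq_zero_iff x y := by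
    rw [← h.eq_zero_iff x y]
    simp [_root_.eMap]

theorem isAntipodal_eMap_neg_iff {ρ : Z → Z → ℝ} (h : IsSeparating ρ) (f : C(Z, ℝ)) :
    IsAntipodal (eMap ρ (-f)) ↔ IsConjugate ρ f f := by
  have hs := h.eMap (-f)
  constructor
  · intro ha
    refine ⟨fun x y => ?_, fun x => ?_⟩
    · rw [← eMap_neg_sq_le_one_iff]
      exact pow_le_one₀ (hs.nonneg x y) (ha.le_one x y)
    · obtain ⟨y, hy⟩ := ha.antipode x
      refine ⟨y, ?_⟩
      rw [← eMap_neg_sq_eq_one_iff, hy, one_pow]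
  · intro hc
    refine ⟨hs, fun x y => ?_, fun x => ?_⟩
    · exact (pow_le_one_iff_of_nonneg (hs.nonneg x y) two_ne_zero).1
        ((eMap_neg_sq_le_one_iff ρ f x y).2 (hc.1 x y))
    · obtain ⟨y, hy⟩ := hc.2 x
      exact ⟨y, (pow_eq_one_iff_of_nonneg (hs.nonneg x y) two_ne_zero).1
        ((eMap_neg_sq_eq_one_iff ρ f x y).2 hy)⟩

theorem moebiusEquiv_eMap (ρ : Z → Z → ℝ) (f : C(Z, ℝ)) : MoebiusEquiv ρ (eMap ρ f) := by
  intro x x' y y' _ _ _ _ _ _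
  have e : Real.exp (f x / 2) * Real.exp (f x' / 2) * Real.exp (f y / 2) *
      Real.exp (f y' / 2) ≠ 0 := by positivity
  simp only [crossRatio, eMap]
  rw [← mul_div_mul_left _ _ e]
  congr 1 <;> ring

theorem dM_eMap [CompactSpace Z] (h4 : HasFourPoints Z) {ρ : Z → Z → ℝ}
    (h : IsSeparating ρ) (f g : C(Z, ℝ)) : dM (eMap ρ f) (eMap ρ g) = dist f g := by
  have hd : mDeriv (eMap ρ f) (eMap ρ g) = fun x => Real.exp (g x - f x) := by
    refine mDeriv_eq h4 (h.eMap f) (by fun_prop) (fun x => Real.exp_pos _) fun x y => ?_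
    rw [eMap_sq, eMap_sq, ← mul_assoc, ← Real.exp_add, ← Real.exp_add]
    congr 2
    ring
  have : Nonempty Z := ⟨h4.choose⟩
  rw [dM, hd, dist_eq_norm, ContinuousMap.norm_eq_iSup_norm]
  simp only [Real.log_exp, ContinuousMap.sub_apply, Real.norm_eq_abs]
  exact iSup_congr fun x => abs_sub_comm _ _

end EMap

theorem MoebiusEquiv.exists_eq_eMap_neg [TopologicalSpace Z] [T1Space Z] (h4 : HasFourPoints Z)
    {ρ₁ ρ₂ : Z → Z → ℝ} (h₁ : IsSeparating ρ₁) (h₂ : IsSeparating ρ₂)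
    (h : MoebiusEquiv ρ₁ ρ₂) : ∃ f : C(Z, ℝ), ρ₂ = eMap ρ₁ (-f) := by
  obtain ⟨F, hc, hF, hd⟩ := h.exists_deriv h4 h₁ h₂
  refine ⟨-⟨fun x => Real.log (F x), hc.log fun x => (hF x).ne'⟩, ?_⟩
  rw [neg_neg]
  funext x y
  refine (pow_left_inj₀ (h₂.nonneg x y) ((h₁.eMap _).nonneg x y) two_ne_zero).1 ?_
  rw [hd, eMap_sq, ContinuousMap.coe_mk, Real.exp_add, Real.exp_log (hF x), Real.exp_log (hF y)]

theorem eMap_neg_zero [TopologicalSpace Z] (ρ : Z → Z → ℝ) : eMap ρ (-0) = ρ := by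
  funext x y
  simp [eMap]

theorem dominates_smul [TopologicalSpace Z] {ρ : Z → Z → ℝ} {g : C(Z, ℝ)}
    (h0 : Dominates ρ 0) (hg : Dominates ρ g) {c : ℝ} (hc : c ∈ Set.Icc (0 : ℝ) 1) :
    Dominates ρ (c • g) := by
  intro x y
  have h1 := h0 x y
  have h2 := hg x y
  simp only [ContinuousMap.zero_apply, ContinuousMap.smul_apply, smul_eq_mul] at h1 ⊢
  rcases le_total (g x + g y) 0 with h | h
  · exact h2.trans (Real.exp_le_exp.2 (by nlinarith [hc.1, hc.2]))
  · exact h1.trans (Real.exp_le_exp.2 (by nlinarith [hc.1, hc.2]))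

/-- Self-conjugate functions are joined to zero by geodesics of self-conjugate functions. -/
theorem exists_geodesic_isConjugate [TopologicalSpace Z] [CompactSpace Z] {ρ : Z → Z → ℝ}
    (h : IsAntipodal ρ) {g : C(Z, ℝ)} (h0 : IsConjugate ρ 0 0) (hg : IsConjugate ρ g g) :
    ∃ γ : ℝ → C(Z, ℝ), (∀ t, IsConjugate ρ (γ t) (γ t)) ∧ γ 0 = 0 ∧ γ (dist 0 g) = g ∧
      ∀ s ∈ Set.Icc 0 (dist 0 g), ∀ t ∈ Set.Icc 0 (dist 0 g), dist (γ s) (γ t) = |s - t| := by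
  obtain ⟨p, hp, hfix, hdist⟩ := exists_retraction h.toIsSeparating.symm h.exists_isConjugate
  set L := dist 0 g with hL
  have hLn : ‖g‖ = L := by rw [hL, dist_zero_left]
  rcases (dist_nonneg : 0 ≤ dist 0 g).eq_or_lt with hL0 | hL0
  · have hg0 : (0 : C(Z, ℝ)) = g := dist_eq_zero.1 hL0.symm
    refine ⟨fun _ => 0, fun _ => h0, rfl, hg0, fun s hs t ht => ?_⟩
    rw [hL, ← hL0, Set.Icc_self, Set.mem_singleton_iff] at hs ht
    simp [hs, ht]
  rw [← hL] at hL0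
  let c : ℝ → ℝ := fun t => Set.projIcc (0 : ℝ) 1 zero_le_one (t / L)
  have hc : ∀ t, Dominates ρ (c t • g) := fun t =>
    dominates_smul h0.1 hg.1 (Set.projIcc (0 : ℝ) 1 zero_le_one (t / L)).2
  have hcI : ∀ t ∈ Set.Icc 0 L, c t = t / L := by
    intro t ht
    simp only [c]
    rw [Set.projIcc_of_mem _ ⟨div_nonneg ht.1 hL0.le, (div_le_one hL0).2 ht.2⟩]
  have hγ0 : p (c 0 • g) = 0 := by
    rw [hcI 0 ⟨le_rfl, hL0.le⟩, zero_div, zero_smul]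
    exact hfix 0 h0
  have hγL : p (c L • g) = g := by
    rw [hcI L ⟨hL0.le, le_rfl⟩, div_self hL0.ne', one_smul]
    exact hfix g hg
  have hle : ∀ s ∈ Set.Icc 0 L, ∀ t ∈ Set.Icc 0 L,
      dist (p (c s • g)) (p (c t • g)) ≤ |s - t| := by
    intro s hs t ht
    refine (hdist _ _ (hc s) (hc t)).trans_eq ?_
    rw [dist_eq_norm, ← sub_smul, norm_smul, hLn, hcI s hs, hcI t ht, ← sub_div,
      Real.norm_eq_abs, abs_div, abs_of_pos hL0, div_mul_cancel₀ _ hL0.ne']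
  have hge : ∀ s ∈ Set.Icc 0 L, ∀ t ∈ Set.Icc 0 L, s ≤ t →
      t - s ≤ dist (p (c s • g)) (p (c t • g)) := by
    intro s hs t ht hst
    have h1 := hle 0 ⟨le_rfl, hL0.le⟩ s hs
    have h2 := hle t ht L ⟨hL0.le, le_rfl⟩
    rw [hγ0, zero_sub, abs_neg, abs_of_nonneg hs.1] at h1
    rw [hγL, abs_sub_comm, abs_of_nonneg (sub_nonneg.2 ht.2)] at h2
    have h3 := dist_triangle4 0 (p (c s • g)) (p (c t • g)) g
    linarith
  refine ⟨fun t => p (c t • g), fun t => hp _ (hc t), hγ0, hγL, fun s hs t ht => ?_⟩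
  refine le_antisymm (hle s hs t ht) ?_
  rcases le_total s t with hst | hst
  · rw [abs_sub_comm, abs_of_nonneg (sub_nonneg.2 hst)]
    exact hge s hs t ht hst
  · rw [abs_of_nonneg (sub_nonneg.2 hst), dist_comm]
    exact hge t ht s hs hst

theorem statement13 [TopologicalSpace Z] [CompactSpace Z]
    [TopologicalSpace.MetrizableSpace Z] (h4 : HasFourPoints Z)
    (ρ₀ : Z → Z → ℝ) (h₀ : IsAntipodal ρ₀) :
    ∀ ρ₁ ρ₂ : MoebiusSpace ρ₀, ∃ γ : ℝ → MoebiusSpace ρ₀,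
      γ 0 = ρ₁ ∧ γ (dM ρ₁.1 ρ₂.1) = ρ₂ ∧
      ∀ s ∈ Set.Icc 0 (dM ρ₁.1 ρ₂.1), ∀ t ∈ Set.Icc 0 (dM ρ₁.1 ρ₂.1),
        dM (γ s).1 (γ t).1 = |s - t| := by
  rintro ⟨ρ₁, h₁, e₁⟩ ⟨ρ₂, h₂, e₂⟩
  have e₁₂ : MoebiusEquiv ρ₁ ρ₂ := fun x x' y y' a b c d e f =>
    (e₁ x x' y y' a b c d e f).symm.trans (e₂ x x' y y' a b c d e f)
  obtain ⟨g, rfl⟩ := e₁₂.exists_eq_eMap_neg h4 h₁.toIsSeparating h₂.toIsSeparating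
  have h0 : IsConjugate ρ₁ 0 0 :=
    (isAntipodal_eMap_neg_iff h₁.toIsSeparating 0).1 (by rwa [eMap_neg_zero])
  have hg : IsConjugate ρ₁ g g := (isAntipodal_eMap_neg_iff h₁.toIsSeparating g).1 h₂
  obtain ⟨γ, hγ, hγ0, hγL, hγd⟩ := exists_geodesic_isConjugate h₁ h0 hg
  have hdM : ∀ f f' : C(Z, ℝ), dM (eMap ρ₁ (-f)) (eMap ρ₁ (-f')) = dist f f' := fun f f' => by
    rw [dM_eMap h4 h₁.toIsSeparating, dist_neg_neg]
  have hL : dM ρ₁ (eMap ρ₁ (-g)) = dist 0 g := by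
    rw [← hdM, eMap_neg_zero]
  refine ⟨fun t => ⟨eMap ρ₁ (-γ t), (isAntipodal_eMap_neg_iff h₁.toIsSeparating _).2 (hγ t),
    fun x x' y y' a b c d e f => (e₁ x x' y y' a b c d e f).trans
      (moebiusEquiv_eMap ρ₁ _ x x' y y' a b c d e f)⟩, ?_, ?_, ?_⟩
  · exact Subtype.ext (by simp only [hγ0, eMap_neg_zero])
  · exact Subtype.ext (by simp only [hL, hγL])
  · simp only [hL, hdM]
    exact hγd
end

section
/- Let (Z,ρ₀) be an antipodal space, ρ₁ ∈ M(Z), ξ₀ ∈ Z, and r > 0. Then there exists ρ₂ ∈ M(Z) such that d_M(ρ₁, ρ₂) = r and the function dρ₂/dρ₁ attains its maximum over Z at the point ξ₀. -/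
open Filter Topology
open scoped Classical

variable {Z : Type*}

/-- A kernel `k` bounded below by zero, at least `2 * r` on the diagonal, and vanishing somewhere on
each row admits an extremal function with values in `[-r, r]` and equal to `r` at `ξ₀`. -/
theorem exists_extremal (k : Z → Z → ℝ) (r : ℝ) (hr : 0 < r)
    (hsymm : ∀ ξ η, k ξ η = k η ξ) (hnonneg : ∀ ξ η, 0 ≤ k ξ η)
    (hdiag : ∀ ξ, 2 * r ≤ k ξ ξ) (hzero : ∀ ξ, ∃ η, k ξ η = 0) (ξ₀ : Z) :
    ∃ τ : Z → ℝ, τ ξ₀ = r ∧ (∀ ξ, τ ξ ≤ r) ∧ (∀ ξ, -r ≤ τ ξ) ∧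
      (∀ ξ η, τ ξ + τ η ≤ k ξ η) ∧ ∀ ξ c, (∀ η, c ≤ k ξ η - τ η) → c ≤ τ ξ := by
  have : Nonempty Z := ⟨ξ₀⟩
  let S : Set (Z → ℝ) := {τ | τ ξ₀ = r ∧ (∀ ξ, τ ξ ≤ r) ∧ ∀ ξ η, τ ξ + τ η ≤ k ξ η}
  have hne : (fun ξ => if ξ = ξ₀ then r else -r) ∈ S := by
    refine ⟨by simp, fun ξ => ?_, fun ξ η => ?_⟩
    · dsimp only
      split_ifs <;> linarith
    · have h1 := hnonneg ξ η
      dsimp only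
      split_ifs with h h'
      · subst h h'
        linarith [hdiag η]
      all_goals linarith
  obtain ⟨τ, -, hτ⟩ := zorn_le_nonempty₀ S (fun C hCS hC y hy => by
    have hbdd : ∀ ξ, BddAbove (Set.range fun f : C => f.1 ξ) := fun ξ =>
      ⟨r, by rintro _ ⟨f, rfl⟩; exact (hCS f.2).2.1 ξ⟩
    have : Nonempty C := ⟨⟨y, hy⟩⟩
    refine ⟨fun ξ => ⨆ f : C, f.1 ξ, ⟨?_, fun ξ => ciSup_le fun f => (hCS f.2).2.1 ξ,
      fun ξ η => ?_⟩, fun f hf ξ => le_ciSup (hbdd ξ) ⟨f, hf⟩⟩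
    · have : ∀ f : C, f.1 ξ₀ = r := fun f => (hCS f.2).1
      simp [this]
    · dsimp only
      rw [← le_sub_iff_add_le]
      refine ciSup_le fun f => ?_
      rw [le_sub_comm]
      refine ciSup_le fun g => ?_
      rcases hC.total f.2 g.2 with h | h
      · linarith [h ξ, (hCS g.2).2.2 ξ η]
      · linarith [h η, (hCS f.2).2.2 ξ η]) _ hne
  obtain ⟨hτ₀, hle, hfeas⟩ := hτ.prop
  have hmax : ∀ ξ c, c ≤ r → (∀ η, c ≤ k ξ η - τ η) → c ≤ τ ξ := by
    intro ξ c hcr hc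
    by_contra! hlt
    have hmem : Function.update τ ξ c ∈ S := by
      refine ⟨?_, fun ζ => ?_, fun ζ η => ?_⟩
      · by_cases h : ξ₀ = ξ
        · subst h
          linarith
        · rw [Function.update_of_ne h, hτ₀]
      · by_cases h : ζ = ξ
        · subst h
          simpa using hcr
        · rw [Function.update_of_ne h]
          exact hle ζ
      · by_cases h : ζ = ξ <;> by_cases h' : η = ξ
        · subst h h'
          simp only [Function.update_self]
          linarith [hdiag η]
        · subst h
          rw [Function.update_self, Function.update_of_ne h']
          linarith [hc η]
        · subst h'
          rw [Function.update_self, Function.update_of_ne h]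
          linarith [hc ζ, hsymm ζ η]
        · rw [Function.update_of_ne h, Function.update_of_ne h']
          exact hfeas ζ η
    have := hτ.le_of_ge hmem (by
      rw [le_update_iff]
      exact ⟨hlt.le, fun _ _ => le_rfl⟩) ξ
    rw [Function.update_self] at this
    linarith
  have hge : ∀ ξ, -r ≤ τ ξ := fun ξ =>
    hmax ξ (-r) (by linarith) fun η => by linarith [hnonneg ξ η, hle η]
  refine ⟨τ, hτ₀, hle, hge, hfeas, fun ξ c hc => hmax ξ c ?_ hc⟩
  obtain ⟨η, hη⟩ := hzero ξ
  linarith [hc η, hge η]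

/-- An extremal function for a continuous kernel on a compact space is continuous. -/
theorem continuous_of_extremal [TopologicalSpace Z] [CompactSpace Z] {k : Z → Z → ℝ} {τ : Z → ℝ}
    (hk : Continuous fun p : Z × Z => k p.1 p.2) (hfeas : ∀ ξ η, τ ξ + τ η ≤ k ξ η)
    (hmax : ∀ ξ c, (∀ η, c ≤ k ξ η - τ η) → c ≤ τ ξ) : Continuous τ := by
  let K : C(Z, C(Z, ℝ)) := ContinuousMap.curry ⟨fun p : Z × Z => k p.1 p.2, hk⟩
  have hK : ∀ ξ η, K ξ η = k ξ η := fun _ _ => rfl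
  have hsub : ∀ ξ ζ, τ ζ - dist (K ξ) (K ζ) ≤ τ ξ := fun ξ ζ => hmax ξ _ fun η => by
    have h := ContinuousMap.dist_apply_le_dist (f := K ξ) (g := K ζ) η
    rw [hK, hK, Real.dist_eq] at h
    linarith [(abs_le.1 h).1, hfeas ζ η]
  refine continuous_iff_continuousAt.2 fun ζ => tendsto_iff_dist_tendsto_zero.2 ?_
  refine squeeze_zero (fun _ => dist_nonneg) (fun ξ => ?_)
    (tendsto_iff_dist_tendsto_zero.1 (K.continuous.tendsto ζ))
  rw [Real.dist_eq, abs_le]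
  have h := hsub ζ ξ
  rw [dist_comm] at h
  constructor <;> linarith [hsub ξ ζ]

/-- The function `eMap ρ τ` is antipodal when `τ` is extremal for `-log ρ²`. -/
theorem IsAntipodal.eMap [TopologicalSpace Z] {ρ : Z → Z → ℝ} (hρ : IsAntipodal ρ) (τ : C(Z, ℝ))
    (hle : ∀ ξ η, ξ ≠ η → τ ξ + τ η ≤ -Real.log (ρ ξ η ^ 2))
    (heq : ∀ ξ, ∃ η, ξ ≠ η ∧ τ ξ + τ η = -Real.log (ρ ξ η ^ 2)) :
    IsAntipodal (eMap ρ τ) := by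
  have hform : ∀ ξ η, ξ ≠ η → _root_.eMap ρ τ ξ η =
      Real.exp ((τ ξ + τ η + Real.log (ρ ξ η ^ 2)) / 2) := by
    intro ξ η h
    have hpos : 0 < ρ ξ η := lt_of_le_of_ne (hρ.toIsSeparating.nonneg ξ η)
      fun h0 => h ((hρ.toIsSeparating.eq_zero_iff ξ η).1 h0.symm)
    have : (τ ξ + τ η + Real.log (ρ ξ η ^ 2)) / 2 = τ ξ / 2 + τ η / 2 + Real.log (ρ ξ η) := by
      rw [Real.log_pow]
      push_cast
      ring
    rw [this, Real.exp_add, Real.exp_add, Real.exp_log hpos, _root_.eMap]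
  refine ⟨⟨?_, fun ξ η => ?_, fun ξ η => ?_, fun ξ η => ?_⟩, fun ξ η => ?_, fun ξ => ?_⟩
  · have := hρ.toIsSeparating.continuous
    unfold _root_.eMap
    fun_prop
  · simp only [_root_.eMap, hρ.toIsSeparating.symm ξ η]
    ring
  · exact mul_nonneg (by positivity) (hρ.toIsSeparating.nonneg ξ η)
  · simp [_root_.eMap, Real.exp_ne_zero, hρ.toIsSeparating.eq_zero_iff]
  · by_cases h : ξ = η
    · simp [_root_.eMap, (hρ.toIsSeparating.eq_zero_iff ξ η).2 h]
    · rw [hform ξ η h, Real.exp_le_one_iff]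
      linarith [hle ξ η h]
  · obtain ⟨η, h, hη⟩ := heq ξ
    exact ⟨η, by rw [hform ξ η h, hη]; simp⟩

theorem crossRatio_eMap [TopologicalSpace Z] (ρ : Z → Z → ℝ) (τ : C(Z, ℝ)) (ξ ξ' η η' : Z) :
    crossRatio (eMap ρ τ) ξ ξ' η η' = crossRatio ρ ξ ξ' η η' := by
  simp only [crossRatio, eMap]
  rw [← mul_div_mul_left (ρ ξ η * ρ ξ' η') (ρ ξ η' * ρ ξ' η)
    (show Real.exp (τ ξ / 2) * Real.exp (τ η / 2) * (Real.exp (τ ξ' / 2) * Real.exp (τ η' / 2)) ≠ 0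
      by positivity)]
  congr 1 <;> ring

/-- The derivative of `eMap ρ τ` with respect to `ρ` is `exp τ`. -/
theorem mDeriv_eMap [TopologicalSpace Z] (h4 : HasFourPoints Z) {ρ : Z → Z → ℝ}
    (hρ : IsSeparating ρ) (τ : C(Z, ℝ)) (ξ : Z) :
    mDeriv ρ (eMap ρ τ) ξ = Real.exp (τ ξ) := by
  have hsq : ∀ ξ η, eMap ρ τ ξ η ^ 2 = Real.exp (τ ξ) * Real.exp (τ η) * ρ ξ η ^ 2 := by
    intro ξ η
    have h : ∀ x : ℝ, Real.exp x = Real.exp (x / 2) ^ 2 := fun x => by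
      rw [← Real.exp_nat_mul]
      congr 1
      push_cast
      ring
    rw [h (τ ξ), h (τ η), eMap]
    ring
  have hex : ∃ f : Z → ℝ, Continuous f ∧ (∀ ξ, 0 < f ξ) ∧
      ∀ ξ η, eMap ρ τ ξ η ^ 2 = f ξ * f η * ρ ξ η ^ 2 :=
    ⟨fun ξ => Real.exp (τ ξ), by fun_prop, fun ξ => Real.exp_pos _, hsq⟩
  rw [mDeriv, dif_pos hex]
  obtain ⟨-, hpos, hf⟩ := hex.choose_spec
  set f := hex.choose
  have hprod : ∀ ξ η, ξ ≠ η → f ξ * f η = Real.exp (τ ξ) * Real.exp (τ η) := fun ξ η h =>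
    mul_right_cancel₀ (pow_ne_zero 2 fun h0 => h ((hρ.eq_zero_iff ξ η).1 h0))
      ((hf ξ η).symm.trans (hsq ξ η))
  obtain ⟨η, ζ, h1, h2, h3⟩ : ∃ η ζ : Z, ξ ≠ η ∧ ξ ≠ ζ ∧ η ≠ ζ := by
    obtain ⟨a, b, c, d, hab, hac, -, hbc, -, -⟩ := h4
    by_cases ha : ξ = a
    · exact ⟨b, c, ha ▸ hab, ha ▸ hac, hbc⟩
    · by_cases hb : ξ = b
      · exact ⟨a, c, ha, hb ▸ hbc, hac⟩
      · exact ⟨a, b, ha, hb, hab⟩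
  have hsquare : f ξ ^ 2 = Real.exp (τ ξ) ^ 2 := by
    refine mul_right_cancel₀ (mul_pos (hpos η) (hpos ζ)).ne' ?_
    calc f ξ ^ 2 * (f η * f ζ) = (f ξ * f η) * (f ξ * f ζ) := by ring
      _ = Real.exp (τ ξ) ^ 2 * (Real.exp (τ η) * Real.exp (τ ζ)) := by
        rw [hprod _ _ h1, hprod _ _ h2]
        ring
      _ = Real.exp (τ ξ) ^ 2 * (f η * f ζ) := by rw [hprod _ _ h3]
  exact (pow_left_inj₀ (hpos ξ).le (Real.exp_pos _).le two_ne_zero).1 hsquare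

theorem statement15 [TopologicalSpace Z] [CompactSpace Z]
    [TopologicalSpace.MetrizableSpace Z] (h4 : HasFourPoints Z)
    (ρ₀ : Z → Z → ℝ) (h₀ : IsAntipodal ρ₀)
    (ρ₁ : Z → Z → ℝ) (hρ₁ : ρ₁ ∈ MoebiusSpace ρ₀) (ξ₀ : Z) (r : ℝ) (hr : 0 < r) :
    ∃ ρ₂ ∈ MoebiusSpace ρ₀, dM ρ₁ ρ₂ = r ∧
      ∀ ζ : Z, mDeriv ρ₁ ρ₂ ζ ≤ mDeriv ρ₁ ρ₂ ξ₀ := by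
  obtain ⟨hρ, hM⟩ := hρ₁
  have hS := hρ.toIsSeparating
  set ε := Real.exp (-(2 * r + 1)) with hε
  have hε0 : 0 < ε := Real.exp_pos _
  have hmpos : ∀ ξ η, 0 < max (ρ₁ ξ η ^ 2) ε := fun ξ η => lt_max_of_lt_right hε0
  have hlogε : -Real.log ε = 2 * r + 1 := by rw [hε, Real.log_exp, neg_neg]
  have hε1 : ε ≤ 1 := Real.exp_le_one_iff.2 (by linarith)
  let k : Z → Z → ℝ := fun ξ η => -Real.log (max (ρ₁ ξ η ^ 2) ε)
  have hk : Continuous fun p : Z × Z => k p.1 p.2 := by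
    have := hS.continuous
    exact (Continuous.log (by fun_prop) fun p : Z × Z => (hmpos p.1 p.2).ne').neg
  have hk_le : ∀ ξ η, ξ ≠ η → k ξ η ≤ -Real.log (ρ₁ ξ η ^ 2) := fun ξ η h =>
    neg_le_neg (Real.log_le_log
      (pow_pos (lt_of_le_of_ne (hS.nonneg ξ η) fun h0 => h ((hS.eq_zero_iff ξ η).1 h0.symm)) 2)
      (le_max_left _ _))
  have hdiag : ∀ ξ, k ξ ξ = 2 * r + 1 := fun ξ => by
    simp only [k, (hS.eq_zero_iff ξ ξ).2 rfl]
    rw [max_eq_right (by simpa using hε0.le), hlogε]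
  obtain ⟨τ, hτ₀, hle, hge, hfeas, hmax⟩ := exists_extremal k r hr
    (fun ξ η => by simp only [k, hS.symm ξ η])
    (fun ξ η => neg_nonneg.2 (Real.log_nonpos (hmpos ξ η).le
      (max_le (pow_le_one₀ (hS.nonneg ξ η) (hρ.le_one ξ η)) hε1)))
    (fun ξ => by linarith [hdiag ξ])
    (fun ξ => by
      obtain ⟨η, hη⟩ := hρ.antipode ξ
      exact ⟨η, by simp only [k, hη]; rw [max_eq_left (by simpa using hε1)]; simp⟩) ξ₀
  have hτc := continuous_of_extremal hk hfeas hmax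
  let T : C(Z, ℝ) := ⟨τ, hτc⟩
  have hT : ∀ ξ, mDeriv ρ₁ (eMap ρ₁ T) ξ = Real.exp (τ ξ) := mDeriv_eMap h4 hS T
  have : Nonempty Z := ⟨ξ₀⟩
  refine ⟨eMap ρ₁ T, ⟨hρ.eMap T (fun ξ η h => (hfeas ξ η).trans (hk_le ξ η h)) fun ξ => ?_, ?_⟩,
    ?_, fun ζ => ?_⟩
  · have hc : Continuous fun η => k ξ η - τ η :=
      (hk.comp (Continuous.prodMk_right ξ)).sub hτc
    obtain ⟨η, -, hη⟩ := isCompact_univ.exists_isMinOn Set.univ_nonempty hc.continuousOn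
    have hval : τ ξ + τ η = k ξ η := by
      linarith [hfeas ξ η, hmax ξ _ fun ζ => hη (Set.mem_univ ζ)]
    have hlt : k ξ η < 2 * r + 1 := by linarith [hle ξ, hle η]
    refine ⟨η, fun h => ?_, hval.trans ?_⟩
    · subst h
      linarith [hdiag ξ]
    · rcases max_choice (ρ₁ ξ η ^ 2) ε with h | h
      · simp only [k, h]
      · simp only [k, h] at hlt
        linarith
  · intro ξ ξ' η η' h1 h2 h3 h4 h5 h6
    rw [crossRatio_eMap]
    exact hM ξ ξ' η η' h1 h2 h3 h4 h5 h6
  · simp only [dM, hT, Real.log_exp]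
    have hb : ∀ ξ, |τ ξ| ≤ r := fun ξ => abs_le.2 ⟨hge ξ, hle ξ⟩
    refine le_antisymm (ciSup_le hb) ?_
    refine le_trans ?_ (le_ciSup ⟨r, by rintro _ ⟨ξ, rfl⟩; exact hb ξ⟩ ξ₀)
    rw [hτ₀]
    exact le_abs_self r
  · rw [hT, hT, hτ₀]
    exact Real.exp_le_exp.2 (hle ζ)
end

section
/- Let (Z,ρ₀) be an antipodal space and suppose that ρ₀ is a K-quasi-metric for some K ≥ 1, i.e. ρ₀(ξ,η) ≤ K·max(ρ₀(ξ,ζ), ρ₀(ζ,η)) for all ξ,η,ζ ∈ Z. Then the metric space (M(Z), d_M) is Gromov hyperbolic: there exists a constant δ ≥ 0 such that (α|β)_ρ ≥ min((α|γ)_ρ, (γ|β)_ρ) − δ for all α, β, γ, ρ ∈ M(Z), where (x|y)_w := (1/2)(d_M(x,w) + d_M(y,w) − d_M(x,y)) is the Gromov product. -/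
open Filter Topology
open scoped Classical

variable {Z : Type*}

/-- `ρ₂` is the conformal change of `ρ₁` with factor `exp τ`. -/
def IsConformalChange (ρ₁ ρ₂ : Z → Z → ℝ) (τ : Z → ℝ) : Prop :=
  ∀ ξ η, ρ₂ ξ η = Real.exp ((τ ξ + τ η) / 2) * ρ₁ ξ η

/-- `ρ` is a `K`-quasi-metric. -/
def IsQuasiMetric (K : ℝ) (ρ : Z → Z → ℝ) : Prop :=
  ∀ ξ η ζ, ρ ξ η ≤ K * max (ρ ξ ζ) (ρ ζ η)

theorem IsSeparating.pos [TopologicalSpace Z] {ρ : Z → Z → ℝ} (h : IsSeparating ρ)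
    {ξ η : Z} (hne : ξ ≠ η) : 0 < ρ ξ η :=
  lt_of_le_of_ne (h.nonneg ξ η) fun h0 => hne ((h.eq_zero_iff ξ η).1 h0.symm)

/-- The ratio of two Moebius equivalent functions has the four-point symmetry. -/
theorem MoebiusEquiv.ratio_mul_ratio [TopologicalSpace Z] {ρ₀ ρ₁ ρ₂ : Z → Z → ℝ}
    (s₁ : IsSeparating ρ₁) (s₂ : IsSeparating ρ₂)
    (h₁ : MoebiusEquiv ρ₀ ρ₁) (h₂ : MoebiusEquiv ρ₀ ρ₂) {a b c d : Z}
    (hab : a ≠ b) (hac : a ≠ c) (had : a ≠ d) (hbc : b ≠ c) (hbd : b ≠ d) (hcd : c ≠ d) :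
    ρ₂ a c / ρ₁ a c * (ρ₂ b d / ρ₁ b d) = ρ₂ a d / ρ₁ a d * (ρ₂ b c / ρ₁ b c) := by
  have h := (h₁ a b c d hab hac had hbc hbd hcd).symm.trans (h₂ a b c d hab hac had hbc hbd hcd)
  unfold crossRatio at h
  have p1 := s₁.pos hac
  have p2 := s₁.pos had
  have p3 := s₁.pos hbc
  have p4 := s₁.pos hbd
  have q2 := s₂.pos had
  have q3 := s₂.pos hbc
  rw [div_eq_div_iff (by positivity) (by positivity)] at h
  rw [div_mul_div_comm, div_mul_div_comm, div_eq_div_iff (by positivity) (by positivity)]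
  linarith

/-- The geometric mean value theorem: Moebius equivalent separating functions differ by a
continuous conformal change. -/
theorem exists_isConformalChange [TopologicalSpace Z] [T1Space Z] (h4 : HasFourPoints Z)
    {ρ₀ ρ₁ ρ₂ : Z → Z → ℝ} (s₁ : IsSeparating ρ₁) (s₂ : IsSeparating ρ₂)
    (h₁ : MoebiusEquiv ρ₀ ρ₁) (h₂ : MoebiusEquiv ρ₀ ρ₂) :
    ∃ τ : Z → ℝ, Continuous τ ∧ IsConformalChange ρ₁ ρ₂ τ := by
  set q : Z → Z → ℝ := fun x y => ρ₂ x y / ρ₁ x y with hq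
  have qpos : ∀ {x y}, x ≠ y → 0 < q x y := fun h => div_pos (s₂.pos h) (s₁.pos h)
  have qsymm : ∀ x y, q x y = q y x := fun x y => by simp only [hq, s₁.symm x y, s₂.symm x y]
  set F : Z → Z → Z → ℝ := fun x y z => q x y * q x z / q y z with hF
  have Fpos : ∀ {x y z}, x ≠ y → x ≠ z → y ≠ z → 0 < F x y z := fun h1 h2 h3 =>
    div_pos (mul_pos (qpos h1) (qpos h2)) (qpos h3)
  have Fsymm : ∀ x y z, F x y z = F x z y := fun x y z => by
    simp only [hF, qsymm y z, mul_comm (q x y)]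
  have Fchange : ∀ {x y z w}, x ≠ y → x ≠ z → y ≠ z → x ≠ w → y ≠ w → F x y z = F x y w := by
    intro x y z w hxy hxz hyz hxw hyw
    by_cases hzw : z = w
    · rw [hzw]
    have := h₁.ratio_mul_ratio s₁ s₂ h₂ hxy hxz hxw hyz hyw hzw
    change q x z * q y w = q x w * q y z at this
    simp only [hF]
    rw [div_eq_div_iff (qpos hyz).ne' (qpos hyw).ne']
    linear_combination q x y * this
  have Findep : ∀ {x y z y' z'}, x ≠ y → x ≠ z → y ≠ z → x ≠ y' → x ≠ z' → y' ≠ z' →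
      F x y z = F x y' z' := by
    intro x y z y' z' hy hz hyz hy' hz' hyz'
    by_cases h : y = z'
    · subst h
      rw [Fchange hy hz hyz hy' hyz'.symm, Fsymm]
    · rw [Fchange hy hz hyz hz' h, Fsymm, Fchange hz' hy (Ne.symm h) hy' hyz'.symm, Fsymm]
  have hpts : ∀ x : Z, ∃ p : Z × Z, x ≠ p.1 ∧ x ≠ p.2 ∧ p.1 ≠ p.2 := by
    intro x
    obtain ⟨y, hy, -⟩ := h4.exists_ne_ne x x
    obtain ⟨z, hz, hzy⟩ := h4.exists_ne_ne x y
    exact ⟨(y, z), hy.symm, hz.symm, hzy.symm⟩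
  choose p hp1 hp2 hp3 using hpts
  set f : Z → ℝ := fun x => F x (p x).1 (p x).2 with hf
  have fpos : ∀ x, 0 < f x := fun x => Fpos (hp1 x) (hp2 x) (hp3 x)
  have fF : ∀ {x y z}, x ≠ y → x ≠ z → y ≠ z → f x = F x y z := fun h1 h2 h3 =>
    Findep (hp1 _) (hp2 _) (hp3 _) h1 h2 h3
  have fcont : Continuous f := by
    rw [continuous_iff_continuousAt]
    intro x
    have hev : ∀ᶠ u in 𝓝 x, F u (p x).1 (p x).2 = f u := by
      filter_upwards [isOpen_ne.mem_nhds (hp1 x), isOpen_ne.mem_nhds (hp2 x)] with u hu1 hu2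
      exact (fF hu1 hu2 (hp3 x)).symm
    refine ContinuousAt.congr ?_ hev
    have c : ∀ {ρ : Z → Z → ℝ}, IsSeparating ρ → ∀ y, ContinuousAt (fun u => ρ u y) x :=
      fun s y => (s.continuous.comp (continuous_id.prodMk continuous_const)).continuousAt
    exact (((c s₂ _).div (c s₁ _) (s₁.pos (hp1 x)).ne').mul
      ((c s₂ _).div (c s₁ _) (s₁.pos (hp2 x)).ne')).div continuousAt_const (qpos (hp3 x)).ne'
  refine ⟨fun x => Real.log (f x), fcont.log fun x => (fpos x).ne', fun x y => ?_⟩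
  by_cases hxy : x = y
  · subst hxy
    rw [(s₁.eq_zero_iff x x).2 rfl, (s₂.eq_zero_iff x x).2 rfl, mul_zero]
  obtain ⟨z, hzx, hzy⟩ := h4.exists_ne_ne x y
  have hprod : f x * f y = q x y ^ 2 := by
    rw [fF hxy hzx.symm hzy.symm, fF (Ne.symm hxy) hzy.symm hzx.symm]
    simp only [hF]
    rw [qsymm y x]
    have := (qpos hzx.symm).ne'
    have := (qpos hzy.symm).ne'
    field_simp
  have hexp : Real.exp ((Real.log (f x) + Real.log (f y)) / 2) = q x y := by
    rw [← Real.log_mul (fpos x).ne' (fpos y).ne', hprod, Real.log_pow]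
    push_cast
    rw [mul_div_cancel_left₀ _ two_ne_zero, Real.exp_log (qpos hxy)]
  rw [hexp]
  exact (div_mul_cancel₀ _ (s₁.pos hxy).ne').symm

theorem IsConformalChange.symm {ρ₁ ρ₂ : Z → Z → ℝ} {τ : Z → ℝ}
    (h : IsConformalChange ρ₁ ρ₂ τ) : IsConformalChange ρ₂ ρ₁ (fun ξ => -τ ξ) := by
  intro ξ η
  rw [h ξ η, ← mul_assoc, ← Real.exp_add]
  ring_nf
  simp

theorem IsConformalChange.trans {ρ₁ ρ₂ ρ₃ : Z → Z → ℝ} {σ τ : Z → ℝ}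
    (h : IsConformalChange ρ₁ ρ₂ σ) (h' : IsConformalChange ρ₂ ρ₃ τ) :
    IsConformalChange ρ₁ ρ₃ (fun ξ => τ ξ + σ ξ) := by
  intro ξ η
  rw [h' ξ η, h ξ η, ← mul_assoc, ← Real.exp_add]
  ring_nf

/-- The logarithm of the derivative is the conformal factor. -/
theorem IsConformalChange.log_mDeriv [TopologicalSpace Z] (h4 : HasFourPoints Z)
    {ρ₁ ρ₂ : Z → Z → ℝ} {τ : Z → ℝ} (s₁ : IsSeparating ρ₁)
    (h : IsConformalChange ρ₁ ρ₂ τ) (hτ : Continuous τ) (ξ : Z) :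
    Real.log (mDeriv ρ₁ ρ₂ ξ) = τ ξ := by
  have hex : ∃ f : Z → ℝ, Continuous f ∧ (∀ ξ, 0 < f ξ) ∧
      ∀ ξ η, ρ₂ ξ η ^ 2 = f ξ * f η * ρ₁ ξ η ^ 2 := by
    refine ⟨fun ξ => Real.exp (τ ξ), Real.continuous_exp.comp hτ,
      fun ξ => Real.exp_pos _, fun ξ η => ?_⟩
    rw [h ξ η, mul_pow, ← Real.exp_add, ← Real.exp_nat_mul]
    congr 2
    push_cast
    ring
  have hm : mDeriv ρ₁ ρ₂ = hex.choose := dif_pos hex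
  obtain ⟨-, hpos, hrel⟩ := hex.choose_spec
  rw [← hm] at hpos hrel
  have key : ∀ {x y : Z}, x ≠ y →
      Real.log (mDeriv ρ₁ ρ₂ x) + Real.log (mDeriv ρ₁ ρ₂ y) = τ x + τ y := by
    intro x y hxy
    have e := hrel x y
    rw [h x y, mul_pow] at e
    have e' := mul_right_cancel₀ (pow_pos (s₁.pos hxy) 2).ne' e
    rw [← Real.log_mul (hpos x).ne' (hpos y).ne', ← e', Real.log_pow, Real.log_exp]
    push_cast
    ring
  obtain ⟨η, hη, -⟩ := h4.exists_ne_ne ξ ξ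
  obtain ⟨ζ, hζ, hζη⟩ := h4.exists_ne_ne ξ η
  linarith [key hη.symm, key hζ.symm, key hζη.symm]

theorem IsConformalChange.dM_eq [TopologicalSpace Z] (h4 : HasFourPoints Z)
    {ρ₁ ρ₂ : Z → Z → ℝ} {τ : Z → ℝ} (s₁ : IsSeparating ρ₁)
    (h : IsConformalChange ρ₁ ρ₂ τ) (hτ : Continuous τ) :
    dM ρ₁ ρ₂ = ⨆ ξ, |τ ξ| := by
  simp only [dM, h.log_mDeriv h4 s₁ hτ]

/-- The conformal factor between antipodal functions attains its sup norm as a maximum. -/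
theorem IsConformalChange.exists_eq_dM [TopologicalSpace Z] [CompactSpace Z]
    (h4 : HasFourPoints Z) {ρ₁ ρ₂ : Z → Z → ℝ} {τ : Z → ℝ}
    (a₁ : IsAntipodal ρ₁) (a₂ : IsAntipodal ρ₂)
    (h : IsConformalChange ρ₁ ρ₂ τ) (hτ : Continuous τ) :
    (∀ ξ, |τ ξ| ≤ dM ρ₁ ρ₂) ∧ ∃ ξ, τ ξ = dM ρ₁ ρ₂ := by
  rw [h.dM_eq h4 a₁.toIsSeparating hτ]
  have : Nonempty Z := ⟨h4.choose⟩
  obtain ⟨ξ, -, hξ⟩ := isCompact_univ.exists_isMaxOn Set.univ_nonempty hτ.abs.continuousOn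
  have hmax : ∀ η, |τ η| ≤ |τ ξ| := fun η => hξ (Set.mem_univ η)
  have hsup : ⨆ η, |τ η| = |τ ξ| :=
    le_antisymm (ciSup_le hmax) (le_ciSup (f := fun η => |τ η|) ⟨|τ ξ|, by
      rintro _ ⟨η, rfl⟩; exact hmax η⟩ ξ)
  rw [hsup]
  refine ⟨hmax, ?_⟩
  rcases le_total 0 (τ ξ) with h0 | h0
  · exact ⟨ξ, (abs_of_nonneg h0).symm⟩
  · obtain ⟨η, hη⟩ := a₂.antipode ξ
    refine ⟨η, le_antisymm ((le_abs_self _).trans (hmax η)) ?_⟩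
    rw [abs_of_nonpos h0]
    have e := h ξ η
    rw [hη] at e
    have : (1 : ℝ) ≤ Real.exp ((τ ξ + τ η) / 2) := by
      rw [e]
      exact mul_le_of_le_one_right (Real.exp_pos _).le (a₁.le_one ξ η)
    have := Real.one_le_exp_iff.1 this
    linarith

/-- A quasi-metric satisfies a Ptolemy type inequality. -/
theorem IsQuasiMetric.ptolemy [TopologicalSpace Z] {ρ : Z → Z → ℝ} (s : IsSeparating ρ)
    {K : ℝ} (hK : 0 ≤ K) (h : IsQuasiMetric K ρ) (ξ η ζ ω : Z) :
    ρ ξ η * ρ ζ ω ≤ K ^ 2 * max (ρ ξ ζ * ρ η ω) (ρ ξ ω * ρ η ζ) := by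
  have step : ∀ x y z w : Z, ρ x z ≤ ρ y z → ρ x z ≤ ρ x w →
      ρ x y * ρ z w ≤ K ^ 2 * (ρ x w * ρ y z) := by
    intro x y z w h1 h2
    have e1 : ρ x y ≤ K * ρ y z := by
      have := h x y z
      rwa [s.symm z y, max_eq_right h1] at this
    have e2 : ρ z w ≤ K * ρ x w := by
      have := h z w x
      rwa [s.symm z x, max_eq_right h2] at this
    calc ρ x y * ρ z w ≤ (K * ρ y z) * (K * ρ x w) :=
          mul_le_mul e1 e2 (s.nonneg _ _) (mul_nonneg hK (s.nonneg _ _))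
      _ = K ^ 2 * (ρ x w * ρ y z) := by ring
  have hl : K ^ 2 * (ρ ξ ζ * ρ η ω) ≤ K ^ 2 * max (ρ ξ ζ * ρ η ω) (ρ ξ ω * ρ η ζ) := by
    gcongr
    exact le_max_left _ _
  have hr : K ^ 2 * (ρ ξ ω * ρ η ζ) ≤ K ^ 2 * max (ρ ξ ζ * ρ η ω) (ρ ξ ω * ρ η ζ) := by
    gcongr
    exact le_max_right _ _
  have c1 := step ξ η ζ ω
  have c2 := step η ξ ω ζ
  have c3 := step ξ η ω ζ
  have c4 := step η ξ ζ ω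
  rw [s.symm η ξ, s.symm ω ζ] at c2
  rw [s.symm ω ζ] at c3
  rw [s.symm η ξ] at c4
  rcases le_total (ρ ξ ζ) (ρ η ζ) with h1 | h1 <;> rcases le_total (ρ ξ ζ) (ρ ξ ω) with h2 | h2 <;>
  rcases le_total (ρ η ω) (ρ η ζ) with h3 | h3 <;> rcases le_total (ρ η ω) (ρ ξ ω) with h4 | h4 <;>
  grind

/-- Antipodal functions conformal to a `K`-quasi-metric are `K ^ 2`-quasi-metrics. -/
theorem IsConformalChange.isQuasiMetric [TopologicalSpace Z] {ρ₀ ρ : Z → Z → ℝ} {τ : Z → ℝ}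
    (s₀ : IsSeparating ρ₀) (a : IsAntipodal ρ) (h : IsConformalChange ρ₀ ρ τ)
    {K : ℝ} (hK : 0 ≤ K) (hq : IsQuasiMetric K ρ₀) : IsQuasiMetric (K ^ 2) ρ := by
  intro ξ η ζ
  obtain ⟨ω, hω⟩ := a.antipode ζ
  set E := Real.exp ((τ ξ + τ η + τ ζ + τ ω) / 2) with hE
  have e1 : ρ ξ η * ρ ζ ω = E * (ρ₀ ξ η * ρ₀ ζ ω) := by
    rw [h, h, mul_mul_mul_comm, ← Real.exp_add, hE]
    ring_nf
  have e2 : ρ ξ ζ * ρ η ω = E * (ρ₀ ξ ζ * ρ₀ η ω) := by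
    rw [h, h, mul_mul_mul_comm, ← Real.exp_add, hE]
    ring_nf
  have e3 : ρ ξ ω * ρ η ζ = E * (ρ₀ ξ ω * ρ₀ η ζ) := by
    rw [h, h, mul_mul_mul_comm, ← Real.exp_add, hE]
    ring_nf
  have s := a.toIsSeparating
  have key : ρ ξ η * ρ ζ ω ≤ K ^ 2 * max (ρ ξ ζ * ρ η ω) (ρ ξ ω * ρ η ζ) := by
    rw [e1, e2, e3, ← mul_max_of_nonneg _ _ (Real.exp_pos _).le]
    have := mul_le_mul_of_nonneg_left (hq.ptolemy s₀ hK ξ η ζ ω) (Real.exp_pos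
      ((τ ξ + τ η + τ ζ + τ ω) / 2)).le
    linarith
  rw [hω, mul_one] at key
  refine key.trans (mul_le_mul_of_nonneg_left (max_le_max ?_ ?_) (by positivity))
  · exact mul_le_of_le_one_right (s.nonneg _ _) (a.le_one _ _)
  · rw [s.symm ζ η]
    exact mul_le_of_le_one_left (s.nonneg _ _) (a.le_one _ _)

/-- The conformal factor of a quasi-metric antipodal function is controlled by the distance
to a point where it is maximal. -/
theorem IsConformalChange.bounds [TopologicalSpace Z] {ρ α : Z → Z → ℝ} {τ : Z → ℝ}
    (aρ : IsAntipodal ρ) (aα : IsAntipodal α) (h : IsConformalChange ρ α τ) {L R : ℝ}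
    (hL : 1 ≤ L) (hq : IsQuasiMetric L α) (hR : ∀ ξ, |τ ξ| ≤ R) {x : Z} (hx : τ x = R) (ξ : Z) :
    τ ξ + R + 2 * Real.log (max (Real.exp (-R)) (ρ x ξ)) ≤ 0 ∧
      0 ≤ τ ξ + R + 2 * Real.log (max (Real.exp (-R)) (ρ x ξ)) + 2 * Real.log L := by
  set m := max (Real.exp (-R)) (ρ x ξ) with hm
  have mpos : 0 < m := lt_max_of_lt_left (Real.exp_pos _)
  set E := Real.exp ((τ ξ + R) / 2) with hE
  have Epos : 0 < E := Real.exp_pos _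
  have logE : Real.log E = (τ ξ + R) / 2 := Real.log_exp _
  have hαx : α x ξ = E * ρ x ξ := by rw [h x ξ, hx, add_comm R]
  have hER : E * Real.exp (-R) = Real.exp ((τ ξ - R) / 2) := by
    rw [hE, ← Real.exp_add]
    ring_nf
  constructor
  · have : E * m ≤ 1 := by
      rw [hm, mul_max_of_nonneg _ _ Epos.le, ← hαx, hER]
      refine max_le (Real.exp_le_one_iff.2 ?_) (aα.le_one _ _)
      linarith [le_abs_self (τ ξ), hR ξ]
    have := Real.log_nonpos (by positivity) this
    rw [Real.log_mul Epos.ne' mpos.ne', logE] at this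
    linarith
  · obtain ⟨ω, hω⟩ := aρ.antipode x
    have hαω : α x ω = Real.exp ((R + τ ω) / 2) := by rw [h x ω, hω, hx, mul_one]
    have hτω : τ ω = -R := by
      have h1 := aα.le_one x ω
      rw [hαω, Real.exp_le_one_iff] at h1
      have := neg_le_of_abs_le (hR ω)
      linarith
    have h1 : α x ω = 1 := by rw [hαω, hτω]; simp
    have h2 : α ξ ω ≤ E * Real.exp (-R) := by
      rw [h ξ ω, hτω, hER, ← sub_eq_add_neg]
      exact mul_le_of_le_one_right (Real.exp_pos _).le (aρ.le_one _ _)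
    have : 1 ≤ L * (E * m) := by
      have hqq := hq x ω ξ
      rw [h1] at hqq
      refine hqq.trans (mul_le_mul_of_nonneg_left (max_le ?_ ?_) (by linarith))
      · rw [hαx]
        gcongr
        exact le_max_right _ _
      · refine h2.trans ?_
        gcongr
        exact le_max_left _ _
    have := Real.log_nonneg this
    rw [Real.log_mul (by positivity) (by positivity), Real.log_mul Epos.ne' mpos.ne', logE] at this
    linarith

/-- Distance estimate: `dM α β` is comparable to `R + S + 2 log max(e⁻ᴿ, e⁻ˢ, ρ(x, y))`. -/
theorem dM_bounds [TopologicalSpace Z] [CompactSpace Z] (h4 : HasFourPoints Z)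
    {ρ α β : Z → Z → ℝ} {σ τ : Z → ℝ}
    (aρ : IsAntipodal ρ) (aα : IsAntipodal α) (aβ : IsAntipodal β)
    (hα : IsConformalChange ρ α σ) (hβ : IsConformalChange ρ β τ)
    (cσ : Continuous σ) (cτ : Continuous τ) {L R S : ℝ} (hL : 1 ≤ L)
    (qρ : IsQuasiMetric L ρ) (qα : IsQuasiMetric L α) (qβ : IsQuasiMetric L β)
    (hR : ∀ ξ, |σ ξ| ≤ R) {x : Z} (hx : σ x = R)
    (hS : ∀ ξ, |τ ξ| ≤ S) {y : Z} (hy : τ y = S) :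
    R + S + 2 * Real.log (max (max (Real.exp (-R)) (Real.exp (-S))) (ρ x y)) ≤ dM α β ∧
      dM α β ≤ R + S + 2 * Real.log (max (max (Real.exp (-R)) (Real.exp (-S))) (ρ x y))
        + 4 * Real.log L := by
  set G := max (max (Real.exp (-R)) (Real.exp (-S))) (ρ x y) with hG
  have bα := hα.bounds aρ aα hL qα hR hx
  have bβ := hβ.bounds aρ aβ hL qβ hS hy
  have s := aρ.toIsSeparating
  obtain ⟨hle, ζ, hζ⟩ := (hα.symm.trans hβ).exists_eq_dM h4 aα aβ (cτ.add cσ.neg)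
  constructor
  · have hxx := hle x
    have hyy := hle y
    have h1 := (bα y).1
    have h2 := (bβ x).1
    rw [s.symm y x] at h2
    rw [abs_le] at hxx hyy
    rcases le_total (Real.exp (-R)) (Real.exp (-S)) with h | h
    · have : G = max (Real.exp (-S)) (ρ x y) := by rw [hG, max_eq_right h]
      rw [this]
      linarith
    · have : G = max (Real.exp (-R)) (ρ x y) := by rw [hG, max_eq_left h]
      rw [this]
      linarith
  · have h1 := (bα ζ).2
    have h1' := (bα ζ).1
    have h2 := (bβ ζ).1
    set u := max (Real.exp (-R)) (ρ x ζ) with hu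
    set v := max (Real.exp (-S)) (ρ y ζ) with hv
    have upos : 0 < u := lt_max_of_lt_left (Real.exp_pos _)
    have vS : Real.exp (-S) ≤ v := le_max_left _ _
    have GS : Real.exp (-S) ≤ G := (le_max_right _ _).trans (le_max_left _ _)
    have GR : Real.exp (-R) ≤ G := (le_max_left _ _).trans (le_max_left _ _)
    have vpos : 0 < v := (Real.exp_pos _).trans_le vS
    have Gpos : 0 < G := (Real.exp_pos _).trans_le GS
    have hmax : u ≤ L * max G v := by
      refine max_le ?_ ?_
      · calc Real.exp (-R) ≤ max G v := GR.trans (le_max_left _ _)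
          _ ≤ L * max G v := le_mul_of_one_le_left (Gpos.le.trans (le_max_left _ _)) hL
      · refine (qρ x ζ y).trans ?_
        gcongr
        · exact le_max_right _ _
        · exact le_max_right _ _
    have hlog := Real.log_le_log upos hmax
    rw [Real.log_mul (by positivity) (lt_max_of_lt_left Gpos).ne'] at hlog
    have lv : -S ≤ Real.log v := (Real.le_log_iff_exp_le vpos).2 vS
    have lG : -S ≤ Real.log G := (Real.le_log_iff_exp_le Gpos).2 GS
    rcases le_total G v with h | h
    · rw [max_eq_right h] at hlog
      linarith
    · rw [max_eq_left h] at hlog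
      linarith

theorem statement17 [TopologicalSpace Z] [CompactSpace Z]
    [TopologicalSpace.MetrizableSpace Z] (h4 : HasFourPoints Z)
    (ρ₀ : Z → Z → ℝ) (h₀ : IsAntipodal ρ₀)
    (K : ℝ) (hK : 1 ≤ K)
    (hqm : ∀ ξ η ζ : Z, ρ₀ ξ η ≤ K * max (ρ₀ ξ ζ) (ρ₀ ζ η)) :
    ∃ δ : ℝ, 0 ≤ δ ∧
      ∀ α β γ ρ : Z → Z → ℝ, α ∈ MoebiusSpace ρ₀ → β ∈ MoebiusSpace ρ₀ →
        γ ∈ MoebiusSpace ρ₀ → ρ ∈ MoebiusSpace ρ₀ →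
        (dM α ρ + dM β ρ - dM α β) / 2 ≥
          min ((dM α ρ + dM γ ρ - dM α γ) / 2) ((dM γ ρ + dM β ρ - dM γ β) / 2) - δ := by
  have hK0 : 0 ≤ K := by linarith
  have hL : 1 ≤ K ^ 2 := one_le_pow₀ hK
  have hk : 0 ≤ Real.log (K ^ 2) := Real.log_nonneg hL
  have hquasi : ∀ {μ}, μ ∈ MoebiusSpace ρ₀ → IsQuasiMetric (K ^ 2) μ := by
    intro μ hμ
    obtain ⟨τ, -, hτ⟩ := exists_isConformalChange h4 h₀.toIsSeparating hμ.1.toIsSeparating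
      (fun _ _ _ _ _ _ _ _ _ _ => rfl) hμ.2
    exact hτ.isQuasiMetric h₀.toIsSeparating hμ.1 hK0 hqm
  refine ⟨3 * Real.log (K ^ 2), by positivity, ?_⟩
  intro α β γ ρ hα hβ hγ hρ
  have data : ∀ {μ}, μ ∈ MoebiusSpace ρ₀ → ∃ τ : Z → ℝ, Continuous τ ∧
      IsConformalChange ρ μ τ ∧ (∀ ξ, |τ ξ| ≤ dM μ ρ) ∧ ∃ x, τ x = dM μ ρ := by
    intro μ hμ
    obtain ⟨τ, cτ, hτ⟩ := exists_isConformalChange h4 hρ.1.toIsSeparating hμ.1.toIsSeparating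
      hρ.2 hμ.2
    have hd : dM μ ρ = dM ρ μ := by
      rw [hτ.dM_eq h4 hρ.1.toIsSeparating cτ, hτ.symm.dM_eq h4 hμ.1.toIsSeparating cτ.neg]
      simp only [abs_neg]
    rw [hd]
    exact ⟨τ, cτ, hτ, hτ.exists_eq_dM h4 hρ.1 hμ.1 cτ⟩
  obtain ⟨a, ca, ha, hRa, x, hx⟩ := data hα
  obtain ⟨b, cb, hb, hRb, y, hy⟩ := data hβ
  obtain ⟨c, cc, hc, hRc, z, hz⟩ := data hγ
  have hab := (dM_bounds h4 hρ.1 hα.1 hβ.1 ha hb ca cb hL (hquasi hρ) (hquasi hα) (hquasi hβ)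
    hRa hx hRb hy).2
  have hac := (dM_bounds h4 hρ.1 hα.1 hγ.1 ha hc ca cc hL (hquasi hρ) (hquasi hα) (hquasi hγ)
    hRa hx hRc hz).1
  have hcb := (dM_bounds h4 hρ.1 hγ.1 hβ.1 hc hb cc cb hL (hquasi hρ) (hquasi hγ) (hquasi hβ)
    hRc hz hRb hy).1
  set p := Real.exp (-dM α ρ) with hp
  set q := Real.exp (-dM β ρ) with hq
  set r := Real.exp (-dM γ ρ) with hr
  set G₁ := max (max p r) (ρ x z) with hG₁
  set G₂ := max (max r q) (ρ z y) with hG₂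
  have p₁ : p ≤ G₁ := (le_max_left _ _).trans (le_max_left _ _)
  have q₂ : q ≤ G₂ := (le_max_right _ _).trans (le_max_left _ _)
  have G₁pos : 0 < G₁ := (Real.exp_pos _).trans_le p₁
  have hmaxpos : 0 < max G₁ G₂ := lt_max_of_lt_left G₁pos
  have hmax : max (max p q) (ρ x y) ≤ K ^ 2 * max G₁ G₂ := by
    refine max_le ?_ ((hquasi hρ x y z).trans ?_)
    · exact (max_le_max p₁ q₂).trans (le_mul_of_one_le_left hmaxpos.le hL)
    · gcongr
      · exact le_max_right _ _
      · exact le_max_right _ _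
  have hlog := Real.log_le_log
    (lt_max_of_lt_left (lt_max_of_lt_left (Real.exp_pos _))) hmax
  rw [Real.log_mul (by positivity) hmaxpos.ne'] at hlog
  rcases le_total G₁ G₂ with h | h
  · rw [max_eq_right h] at hlog
    refine ge_iff_le.2 ((sub_le_sub_right (min_le_right _ _) _).trans ?_)
    linarith
  · rw [max_eq_left h] at hlog
    refine ge_iff_le.2 ((sub_le_sub_right (min_le_left _ _) _).trans ?_)
    linarith
end
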